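/- arXiv:1102.1078 — 3 statements merged into one kernel-verified Lean document; each statement's English description precedes it below -/
import Mathlib

section
/- For all real a, b, c > 0 and every fixed r ∈ (0,1), the function g(p) = F(a,b;c;r^p)^{1/p} is strictly decreasing on (0,∞). In particular, for every p ≥ 1 one has F(a,b;c;r^p)^{1/p} ≤ F(a,b;c;r) ≤ F(a,b;c;r^{1/p})^p. -/
open Real Set

/-- Shifted factorial (Pochhammer/Appell symbol) `(a)ₙ`. -/
noncomputable def shiftedFact (a : ℝ) : ℕ → ℝ
  | 0 => 1
  | n + 1 => shiftedFact a n * (a + n)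

/-- Gaussian hypergeometric function `F(a,b;c;x)` as a series. -/
noncomputable def hypF (a b c x : ℝ) : ℝ :=
  ∑' n : ℕ, shiftedFact a n * shiftedFact b n / (shiftedFact c n * (Nat.factorial n : ℝ)) * x ^ n

/-- Generalized complete elliptic integral of the first kind `𝒦ₐ(r)`. -/
noncomputable def ellK (a r : ℝ) : ℝ := (Real.pi / 2) * hypF a (1 - a) 1 (r ^ 2)

/-- Generalized complete elliptic integral of the second kind `ℰₐ(r)`. -/
noncomputable def ellE (a r : ℝ) : ℝ := (Real.pi / 2) * hypF (a - 1) (1 - a) 1 (r ^ 2)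

/-- The generalized Grötzsch modulus `μₐ(r)`. -/
noncomputable def muFn (a r : ℝ) : ℝ :=
  Real.pi / (2 * Real.sin (Real.pi * a)) * ellK a (Real.sqrt (1 - r ^ 2)) / ellK a r

/-- Inverse of `μₐ` (on `(0,1)`, where it is a decreasing homeomorphism onto `(0,∞)`). -/
noncomputable def muInv (a : ℝ) : ℝ → ℝ := Function.invFunOn (muFn a) (Set.Ioo 0 1)

/-- The generalized modular function `φ_K^a(r)`. -/
noncomputable def phiK (a K r : ℝ) : ℝ := muInv a (muFn a r / K)

/-- `η_K^a(x) = (s/s')²` where `s = φ_K^a(√(x/(1+x)))`. -/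
noncomputable def etaK (a K x : ℝ) : ℝ :=
  ((phiK a K (Real.sqrt (x / (1 + x)))) / Real.sqrt (1 - (phiK a K (Real.sqrt (x / (1 + x)))) ^ 2)) ^ 2

/-- `λₐ(K)`. -/
noncomputable def lambdaA (a K : ℝ) : ℝ :=
  (phiK a K (1 / Real.sqrt 2) / phiK a (1 / K) (1 / Real.sqrt 2)) ^ 2

/-- The generalized inverse hyperbolic tangent `artanh_p`. -/
noncomputable def artanhp (p x : ℝ) : ℝ := ∫ t in (0:ℝ)..x, (1 - t ^ p)⁻¹

/-- The inverse hyperbolic tangent. -/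
noncomputable def artanh (x : ℝ) : ℝ := (1 / 2) * Real.log ((1 + x) / (1 - x))

/-- Euler beta function. -/
noncomputable def betaB (x y : ℝ) : ℝ := Real.Gamma x * Real.Gamma y / Real.Gamma (x + y)

/-- `μ_{a,c}(r)`, the two-parameter generalized modulus. -/
noncomputable def muAC (a c r : ℝ) : ℝ :=
  betaB a (c - a) * hypF a (c - a) c (1 - r ^ 2) / (2 * hypF a (c - a) c (r ^ 2))

/-- Inverse of `μ_{a,c}` on `(0,1)`. -/
noncomputable def muACInv (a c : ℝ) : ℝ → ℝ := Function.invFunOn (muAC a c) (Set.Ioo 0 1)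

/-- The modular function `φ_K^{a,c}(r)`. -/
noncomputable def phiAC (a c K r : ℝ) : ℝ := muACInv a c (muAC a c r / K)

lemma shiftedFact_pos' {a : ℝ} (ha : 0 < a) (n : ℕ) : 0 < shiftedFact a n := by
  induction n with
  | zero => simp [shiftedFact]
  | succ k ih => rw [shiftedFact]; positivity

lemma hyp_summable {a b c x : ℝ} (ha : 0 < a) (hb : 0 < b) (hc : 0 < c) (hx : 0 ≤ x)
    (hx1 : x < 1) : Summable (fun n : ℕ => shiftedFact a n * shiftedFact b n /
      (shiftedFact c n * (Nat.factorial n : ℝ)) * x ^ n) := by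
  rcases hx.eq_or_lt with rfl | hx
  · apply summable_of_ne_finset_zero (s := {0})
    intro n hn
    simp at hn
    simp [hn]
  have pos : ∀ n : ℕ, 0 < shiftedFact a n * shiftedFact b n /
      (shiftedFact c n * (Nat.factorial n : ℝ)) * x ^ n := fun n => by
    have := shiftedFact_pos' ha n
    have := shiftedFact_pos' hb n
    have := shiftedFact_pos' hc n
    positivity
  apply summable_of_ratio_test_tendsto_lt_one hx1
    (Filter.Eventually.of_forall fun n => (pos n).ne')
  have h1 := tendsto_add_mul_div_add_mul_atTop_nhds a c 1 (one_ne_zero (α := ℝ))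
  have h2 := tendsto_add_mul_div_add_mul_atTop_nhds b 1 1 (one_ne_zero (α := ℝ))
  have h3 := (h1.mul h2).mul_const x
  simp only [div_one, one_mul] at h3
  refine h3.congr fun n => ?_
  rw [Real.norm_of_nonneg (pos _).le, Real.norm_of_nonneg (pos _).le]
  have := shiftedFact_pos' ha n
  have := shiftedFact_pos' hb n
  have := shiftedFact_pos' hc n
  have : 0 < c + n := by positivity
  have : (0:ℝ) < 1 + n := by positivity
  have : (0:ℝ) < n + 1 := by positivity
  simp only [shiftedFact, Nat.factorial_succ, pow_succ]
  push_cast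
  field_simp
  try ring

lemma hyp_lt {a b c x y : ℝ} (ha : 0 < a) (hb : 0 < b) (hc : 0 < c) (hx : 0 ≤ x)
    (hxy : x < y) (hy : y < 1) : hypF a b c x < hypF a b c y := by
  have pos : ∀ n : ℕ, 0 < shiftedFact a n * shiftedFact b n /
      (shiftedFact c n * (Nat.factorial n : ℝ)) := fun n => by
    have := shiftedFact_pos' ha n
    have := shiftedFact_pos' hb n
    have := shiftedFact_pos' hc n
    positivity
  refine Summable.tsum_lt_tsum (i := 1) (fun n => ?_) ?_
    (hyp_summable ha hb hc hx (hxy.trans hy))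
    (hyp_summable ha hb hc (hx.trans hxy.le) hy)
  · exact mul_le_mul_of_nonneg_left (pow_le_pow_left₀ hx hxy.le n) (pos n).le
  · exact mul_lt_mul_of_pos_left (by simpa using hxy) (pos 1)

lemma hyp_zero (a b c : ℝ) : hypF a b c 0 = 1 := by
  unfold hypF
  rw [tsum_eq_single 0]
  · simp [shiftedFact]
  · intro n hn
    simp [hn]

theorem stmt0 (a b c : ℝ) (ha : 0 < a) (hb : 0 < b) (hc : 0 < c)
    (r : ℝ) (hr : r ∈ Set.Ioo (0:ℝ) 1) :
    StrictAntiOn (fun p : ℝ => (hypF a b c (r ^ p)) ^ (1 / p)) (Set.Ioi 0) ∧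
    ∀ p : ℝ, 1 ≤ p →
      (hypF a b c (r ^ p)) ^ (1 / p) ≤ hypF a b c r ∧
      hypF a b c r ≤ (hypF a b c (r ^ (1 / p))) ^ p := by
  have key : StrictAntiOn (fun p : ℝ => (hypF a b c (r ^ p)) ^ (1 / p)) (Set.Ioi 0) := by
    intro p hp q hq hpq
    have hp : 0 < p := hp
    have hq : 0 < q := hq
    have l1 : r ^ q < r ^ p := Real.rpow_lt_rpow_of_exponent_gt hr.1 hr.2 hpq
    have l2 : r ^ p < 1 := Real.rpow_lt_one hr.1.le hr.2 hp
    have l3 : 0 < r ^ q := Real.rpow_pos_of_pos hr.1 q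
    have l4 := hyp_lt ha hb hc l3.le l1 l2
    have l5 := hyp_lt ha hb hc le_rfl l3 (l1.trans l2)
    rw [hyp_zero] at l5
    have hi : 1 / q < 1 / p := one_div_lt_one_div_of_lt hp hpq
    exact (Real.rpow_lt_rpow (by linarith) l4 (by positivity)).trans
      (Real.rpow_lt_rpow_of_exponent_lt (by linarith) hi)
  refine ⟨key, fun p hp => ?_⟩
  have hp0 : 0 < p := by linarith
  have h1 := key.antitoneOn (Set.mem_Ioi.2 one_pos) (Set.mem_Ioi.2 hp0) hp
  have h2 := key.antitoneOn (Set.mem_Ioi.2 (one_div_pos.2 hp0)) (Set.mem_Ioi.2 one_pos)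
    (by rw [div_le_one hp0]; exact hp)
  simp only [one_div_one_div, Real.rpow_one, div_one] at h1 h2
  exact ⟨h1, h2⟩
end

section
/- For every a ∈ (0,1/2], the function f(x) = 1/𝒦_a(1/cosh(x)) is strictly increasing and concave from (0,∞) onto (0, 2/π). Consequently, for all r, s ∈ (0,1), with r' = √(1-r²), s' = √(1-s²): 𝒦_a(r)𝒦_a(s)/𝒦_a(rs/(1+r's')) ≤ 𝒦_a(r) + 𝒦_a(s) ≤ 2𝒦_a(r)𝒦_a(s)/𝒦_a(√(2rs/(1+rs+r's'))) ≤ 2𝒦_a(r)𝒦_a(s)/𝒦_a(√(rs)), with equality in the third inequality if and only if r = s. -/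
open Real Set

noncomputable def cfA (a : ℝ) (n : ℕ) : ℝ :=
  shiftedFact a n * shiftedFact (1 - a) n / (shiftedFact 1 n * (Nat.factorial n : ℝ))

lemma sF_one (n : ℕ) : shiftedFact 1 n = (Nat.factorial n : ℝ) := by
  induction n with
  | zero => simp [shiftedFact]
  | succ k ih => rw [shiftedFact, ih, Nat.factorial_succ]; push_cast; ring

lemma cfA_zero (a : ℝ) : cfA a 0 = 1 := by simp [cfA, shiftedFact]

lemma cfA_succ (a : ℝ) (n : ℕ) :
    ((n : ℝ) + 1) * cfA a (n + 1) = cfA a n * ((n : ℝ) + a * (1 - a) / (n + 1)) := by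
  have h1 : (Nat.factorial n : ℝ) ≠ 0 := by positivity
  have h2 : (n : ℝ) + 1 ≠ 0 := by positivity
  simp only [cfA, sF_one, Nat.factorial_succ, shiftedFact]
  push_cast
  field_simp
  ring

lemma pA_pos {a : ℝ} (ha : a ∈ Set.Ioc (0:ℝ) (1/2)) : 0 < a * (1 - a) := by
  have := ha.1; have := ha.2
  exact mul_pos ha.1 (by linarith)

lemma pA_le (a : ℝ) : a * (1 - a) ≤ 1 / 4 := by nlinarith [sq_nonneg (a - 1/2)]

lemma cfA_pos {a : ℝ} (ha : a ∈ Set.Ioc (0:ℝ) (1/2)) (n : ℕ) : 0 < cfA a n := by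
  have hp := pA_pos ha
  induction n with
  | zero => rw [cfA_zero]; norm_num
  | succ k ih =>
    have h := cfA_succ a k
    have h2 : 0 < cfA a k * ((k : ℝ) + a * (1 - a) / (k + 1)) := by positivity
    rw [← h] at h2
    exact pos_of_mul_pos_right h2 (by positivity)

lemma cfA_le_one {a : ℝ} (ha : a ∈ Set.Ioc (0:ℝ) (1/2)) (n : ℕ) : cfA a n ≤ 1 := by
  have hp := pA_pos ha
  induction n with
  | zero => rw [cfA_zero]
  | succ k ih =>
    have h := cfA_succ a k
    have h2 : a * (1 - a) / ((k : ℝ) + 1) ≤ 1 := by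
      rw [div_le_one (by positivity)]
      have := pA_le a
      have : (0 : ℝ) ≤ k := by positivity
      linarith
    have h3 : cfA a k * ((k : ℝ) + a * (1 - a) / (k + 1)) ≤ 1 * (k + 1) := by
      have := cfA_pos ha k
      gcongr
    rw [← h] at h3
    have : (0 : ℝ) < k + 1 := by positivity
    nlinarith

lemma cfA_lower {a : ℝ} (ha : a ∈ Set.Ioc (0:ℝ) (1/2)) (n : ℕ) :
    a * (1 - a) ≤ ((n : ℝ) + 1) * cfA a (n + 1) := by
  have hp := pA_pos ha
  induction n with
  | zero => rw [cfA_succ, cfA_zero]; simp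
  | succ k ih =>
    rw [cfA_succ]
    have := cfA_pos ha (k + 1)
    push_cast at *
    have h4 : 0 ≤ a * (1 - a) / ((k : ℝ) + 1 + 1) := by positivity
    nlinarith

noncomputable def FA (a x : ℝ) : ℝ := ∑' n : ℕ, cfA a n * x ^ n
noncomputable def DA (a x : ℝ) : ℝ := ∑' n : ℕ, cfA a n * (n * x ^ (n - 1))
noncomputable def HA (a x : ℝ) : ℝ := ∑' n : ℕ, cfA a n * (a * (1 - a) / (n + 1)) * x ^ n

lemma ellK_eq (a r : ℝ) : ellK a r = Real.pi / 2 * FA a (r ^ 2) := rfl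

lemma summ_bdd {x : ℝ} (hx : |x| < 1) {c : ℕ → ℝ} (hc : ∀ n, |c n| ≤ 1) :
    Summable fun n : ℕ => c n * x ^ n := by
  refine Summable.of_norm_bounded (g := fun n => |x| ^ n)
    (summable_geometric_of_lt_one (abs_nonneg _) hx) ?_
  intro n
  rw [norm_mul, norm_pow, Real.norm_eq_abs, Real.norm_eq_abs]
  exact mul_le_of_le_one_left (by positivity) (hc n)

lemma cfA_abs {a : ℝ} (ha : a ∈ Set.Ioc (0:ℝ) (1/2)) (n : ℕ) : |cfA a n| ≤ 1 := by
  rw [abs_of_pos (cfA_pos ha n)]; exact cfA_le_one ha n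

lemma FA_summ {a : ℝ} (ha : a ∈ Set.Ioc (0:ℝ) (1/2)) {x : ℝ} (hx : |x| < 1) :
    Summable fun n : ℕ => cfA a n * x ^ n := summ_bdd hx (cfA_abs ha)

lemma hc_bound {a : ℝ} (ha : a ∈ Set.Ioc (0:ℝ) (1/2)) (n : ℕ) :
    a * (1 - a) / ((n : ℝ) + 1) ≤ 1 / 4 := by
  rw [div_le_iff₀ (by positivity)]
  have := pA_le a
  have : (0 : ℝ) ≤ n := by positivity
  linarith

lemma HA_summ {a : ℝ} (ha : a ∈ Set.Ioc (0:ℝ) (1/2)) {x : ℝ} (hx : |x| < 1) :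
    Summable fun n : ℕ => cfA a n * (a * (1 - a) / (n + 1)) * x ^ n := by
  refine summ_bdd hx fun n => ?_
  have hp := pA_pos ha
  have h1 := cfA_pos ha n
  have h2 := cfA_le_one ha n
  have h3 := hc_bound ha n
  have h4 : 0 < a * (1 - a) / ((n : ℝ) + 1) := by positivity
  rw [abs_of_pos (by positivity)]
  nlinarith

lemma dsumm {ρ : ℝ} (h0 : 0 ≤ ρ) (h1 : ρ < 1) : Summable fun n : ℕ => (n : ℝ) * ρ ^ (n - 1) := by
  rw [← summable_nat_add_iff 1]
  have h := summable_pow_mul_geometric_of_norm_lt_one (R := ℝ) 1 (r := ρ)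
    (by rwa [Real.norm_eq_abs, abs_of_nonneg h0])
  have h' := summable_geometric_of_lt_one h0 h1
  refine (h.add h').congr fun n => ?_
  simp; ring

lemma DA_summ {a : ℝ} (ha : a ∈ Set.Ioc (0:ℝ) (1/2)) {x : ℝ} (hx : |x| < 1) :
    Summable fun n : ℕ => cfA a n * (n * x ^ (n - 1)) := by
  refine Summable.of_norm_bounded (dsumm (abs_nonneg x) hx) ?_
  intro n
  rw [norm_mul, norm_mul, norm_pow, Real.norm_eq_abs, Real.norm_eq_abs, Real.norm_eq_abs,
    Nat.abs_cast]
  exact mul_le_of_le_one_left (by positivity) (cfA_abs ha n)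

lemma FA_deriv {a : ℝ} (ha : a ∈ Set.Ioc (0:ℝ) (1/2)) {x : ℝ} (hx : |x| < 1) :
    HasDerivAt (FA a) (DA a x) x := by
  obtain ⟨ρ, h1, h2⟩ := exists_between hx
  have h0 : 0 ≤ ρ := (abs_nonneg x).trans h1.le
  refine hasDerivAt_tsum_of_isPreconnected (g := fun n y => cfA a n * y ^ n)
    (g' := fun n y => cfA a n * (n * y ^ (n - 1))) (t := Metric.ball 0 ρ) (y₀ := x)
    (dsumm h0 h2) Metric.isOpen_ball (convex_ball _ _).isPreconnected ?_ ?_ (by simpa using h1)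
    (FA_summ ha hx) (by simpa using h1)
  · intro n y _
    exact (hasDerivAt_pow n y).const_mul _
  · intro n y hy
    have hy' : |y| ≤ ρ := by simpa using (Metric.mem_ball.1 hy).le
    rw [norm_mul, norm_mul, norm_pow, Real.norm_eq_abs, Real.norm_eq_abs, Real.norm_eq_abs,
      Nat.abs_cast]
    refine (mul_le_of_le_one_left (by positivity) (cfA_abs ha n)).trans ?_
    gcongr

lemma DA_HA {a : ℝ} (ha : a ∈ Set.Ioc (0:ℝ) (1/2)) {x : ℝ} (hx : |x| < 1) :
    (1 - x) * DA a x = HA a x := by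
  have hS : HasSum (fun n : ℕ => cfA a n * (n * x ^ (n - 1))) (DA a x) := (DA_summ ha hx).hasSum
  have hS1 := (hasSum_nat_add_iff' 1).2 hS
  have hS2 := hS.mul_left x
  have h3 := hS1.sub hS2
  have h5 : ∀ n : ℕ, cfA a (n + 1) * (((n + 1 : ℕ) : ℝ) * x ^ (n + 1 - 1)) -
      x * (cfA a n * ((n : ℝ) * x ^ (n - 1))) = cfA a n * (a * (1 - a) / (n + 1)) * x ^ n := by
    intro n
    have h := cfA_succ a n
    have h6 : x * ((n : ℝ) * x ^ (n - 1)) = n * x ^ n := by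
      cases n with
      | zero => simp
      | succ k => simp [pow_succ]; ring
    push_cast
    linear_combination x ^ n * h - cfA a n * h6
  simp only [h5] at h3
  have h4 := h3.tsum_eq
  unfold HA
  rw [h4]; simp; ring

lemma FA_zero (a : ℝ) : FA a 0 = 1 := by
  unfold FA
  rw [tsum_eq_single 0]
  · simp [cfA_zero]
  · intro n hn; simp [hn]

lemma FA_strict {a : ℝ} (ha : a ∈ Set.Ioc (0:ℝ) (1/2)) : StrictMonoOn (FA a) (Set.Ico 0 1) := by
  intro x hx y hy hxy
  have hx' : |x| < 1 := by rw [abs_of_nonneg hx.1]; exact hx.2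
  have hy' : |y| < 1 := by rw [abs_of_nonneg hy.1]; exact hy.2
  refine Summable.tsum_lt_tsum (i := 1) (fun n => ?_) ?_ (FA_summ ha hx') (FA_summ ha hy')
  · exact mul_le_mul_of_nonneg_left (pow_le_pow_left₀ hx.1 hxy.le n) (cfA_pos ha n).le
  · simpa using mul_lt_mul_of_pos_left hxy (cfA_pos ha 1)

lemma FA_pos {a : ℝ} (ha : a ∈ Set.Ioc (0:ℝ) (1/2)) {x : ℝ} (hx : x ∈ Set.Ico (0:ℝ) 1) :
    1 ≤ FA a x := by
  rw [← FA_zero a]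
  exact (FA_strict ha).monotoneOn ⟨le_refl _, by norm_num⟩ hx hx.1

lemma HA_mono {a : ℝ} (ha : a ∈ Set.Ioc (0:ℝ) (1/2)) : MonotoneOn (HA a) (Set.Ico 0 1) := by
  intro x hx y hy hxy
  have hx' : |x| < 1 := by rw [abs_of_nonneg hx.1]; exact hx.2
  have hy' : |y| < 1 := by rw [abs_of_nonneg hy.1]; exact hy.2
  have hp := pA_pos ha
  refine Summable.tsum_le_tsum (fun n => ?_) (HA_summ ha hx') (HA_summ ha hy')
  have := cfA_pos ha n
  exact mul_le_mul_of_nonneg_left (pow_le_pow_left₀ hx.1 hxy n) (by positivity)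

lemma HA_nonneg {a : ℝ} (ha : a ∈ Set.Ioc (0:ℝ) (1/2)) {x : ℝ} (hx : x ∈ Set.Ico (0:ℝ) 1) :
    0 ≤ HA a x := by
  have hp := pA_pos ha
  refine tsum_nonneg fun n => ?_
  have := cfA_pos ha n
  have := hx.1
  positivity

lemma HA_le {a : ℝ} (ha : a ∈ Set.Ioc (0:ℝ) (1/2)) {x : ℝ} (hx : x ∈ Set.Ico (0:ℝ) 1) :
    4 * HA a x ≤ FA a x := by
  have hx' : |x| < 1 := by rw [abs_of_nonneg hx.1]; exact hx.2
  unfold HA FA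
  rw [← tsum_mul_left]
  refine Summable.tsum_le_tsum (fun n => ?_) ((HA_summ ha hx').mul_left 4) (FA_summ ha hx')
  have h1 := cfA_pos ha n
  have h3 := hc_bound ha n
  have h0 := hx.1
  have h5 : 0 ≤ cfA a n * x ^ n := by positivity
  nlinarith

lemma NA_anti {a : ℝ} (ha : a ∈ Set.Ioc (0:ℝ) (1/2)) :
    AntitoneOn (fun x => (1 - x) * FA a x ^ 4) (Set.Ico 0 1) := by
  have hd : ∀ x ∈ Set.Ico (0:ℝ) 1, HasDerivAt (fun x => (1 - x) * FA a x ^ 4)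
      (FA a x ^ 3 * (4 * HA a x - FA a x)) x := by
    intro x hx
    have hx' : |x| < 1 := by rw [abs_of_nonneg hx.1]; exact hx.2
    have h := ((hasDerivAt_id x).const_sub 1).mul ((FA_deriv ha hx').pow 4)
    refine h.congr_deriv ?_
    rw [← DA_HA ha hx']
    simp; ring
  refine antitoneOn_of_deriv_nonpos (convex_Ico 0 1) ?_ ?_ ?_
  · exact fun x hx => (hd x hx).continuousAt.continuousWithinAt
  · exact fun x hx => (hd x (interior_subset hx)).differentiableAt.differentiableWithinAt
  · intro x hx
    have hx := interior_subset hx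
    rw [(hd x hx).deriv]
    have := FA_pos ha hx
    exact mul_nonpos_of_nonneg_of_nonpos (by positivity) (by linarith [HA_le ha hx])

lemma FA_log {a : ℝ} (ha : a ∈ Set.Ioc (0:ℝ) (1/2)) {x : ℝ} (hx : x ∈ Set.Ico (0:ℝ) 1) :
    a * (1 - a) * (- Real.log (1 - x)) ≤ FA a x := by
  have hx' : |x| < 1 := by rw [abs_of_nonneg hx.1]; exact hx.2
  have h1 := (Real.hasSum_pow_div_log_of_abs_lt_one hx').mul_left (a * (1 - a))
  have h2 := (hasSum_nat_add_iff' 1).2 (FA_summ ha hx').hasSum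
  have h3 := hasSum_le (fun n => ?_) h1 h2
  · simp [cfA_zero] at h3
    unfold FA
    linarith
  · have := cfA_lower ha n
    have h0 := hx.1
    rw [← mul_div_assoc, div_le_iff₀ (by positivity)]
    have : 0 ≤ x ^ (n+1) := by positivity
    nlinarith

lemma uA_mem {t : ℝ} (ht : 0 < t) : (1 / Real.cosh t) ^ 2 ∈ Set.Ioo (0:ℝ) 1 := by
  have h := Real.one_lt_cosh.2 ht.ne'
  have h1 : 1 / Real.cosh t < 1 := by rw [div_lt_one (by linarith)]; exact h
  have h0 : 0 < 1 / Real.cosh t := by positivity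
  exact ⟨by positivity, by nlinarith⟩

lemma uA_anti {s t : ℝ} (hs : 0 < s) (ht : s < t) :
    (1 / Real.cosh t) ^ 2 < (1 / Real.cosh s) ^ 2 := by
  have h := Real.cosh_lt_cosh.2 (by rwa [abs_of_pos hs, abs_of_pos (hs.trans ht)] : |s| < |t|)
  have := Real.cosh_pos s
  gcongr

lemma fA_deriv {a : ℝ} (ha : a ∈ Set.Ioc (0:ℝ) (1/2)) {t : ℝ} (ht : 0 < t) :
    HasDerivAt (fun x : ℝ => 1 / ellK a (1 / Real.cosh x))
      (4 / Real.pi * ((1 / Real.cosh t) ^ 2 * HA a ((1 / Real.cosh t) ^ 2) /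
        Real.sqrt ((1 - (1 / Real.cosh t) ^ 2) * FA a ((1 / Real.cosh t) ^ 2) ^ 4))) t := by
  have hu := uA_mem ht
  have hc := Real.cosh_pos t
  have hs := Real.sinh_pos_iff.2 ht
  have hcs := Real.cosh_sq t
  have hx' : |(1 / Real.cosh t) ^ 2| < 1 := by rw [abs_of_nonneg hu.1.le]; exact hu.2
  have hF := FA_pos ha ⟨hu.1.le, hu.2⟩
  have hu' : HasDerivAt (fun x : ℝ => (1 / Real.cosh x) ^ 2)
      (-2 * Real.sinh t / Real.cosh t ^ 3) t := by
    have h := (((Real.hasDerivAt_cosh t).inv hc.ne').pow 2)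
    refine (h.congr_deriv ?_).congr_of_eventuallyEq (Filter.Eventually.of_forall fun x => ?_)
    · simp; field_simp
    · simp
  have hd := ((((FA_deriv ha hx').comp t hu').const_mul (Real.pi / 2)).inv
    (by simp only [Function.comp]; positivity))
  refine (hd.congr_deriv ?_).congr_of_eventuallyEq (Filter.Eventually.of_forall fun x => ?_)
  · rw [← DA_HA ha hx']
    have e : (1 - (1 / Real.cosh t) ^ 2) = (Real.sinh t / Real.cosh t) ^ 2 := by
      field_simp; linarith
    have e2 : Real.sqrt ((1 - (1 / Real.cosh t) ^ 2) * FA a ((1 / Real.cosh t) ^ 2) ^ 4) =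
        (Real.sinh t / Real.cosh t) * FA a ((1 / Real.cosh t) ^ 2) ^ 2 := by
      rw [Real.sqrt_eq_iff_mul_self_eq (by rw [e]; positivity) (by positivity), e]; ring
    rw [e2, e]
    simp only [Function.comp]
    have := Real.pi_pos
    have hF0 : FA a ((1 / Real.cosh t) ^ 2) ≠ 0 := by positivity
    generalize FA a ((1 / Real.cosh t) ^ 2) = F at *
    generalize DA a ((1 / Real.cosh t) ^ 2) = D at *
    field_simp
    ring
  · simp [ellK_eq, Function.comp]

lemma fA_concave {a : ℝ} (ha : a ∈ Set.Ioc (0:ℝ) (1/2)) :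
    ConcaveOn ℝ (Set.Ioi 0) (fun x : ℝ => 1 / ellK a (1 / Real.cosh x)) := by
  refine AntitoneOn.concaveOn_of_deriv (convex_Ioi 0) ?_ ?_ ?_
  · exact fun x hx => (fA_deriv ha hx).continuousAt.continuousWithinAt
  · intro x hx
    exact (fA_deriv ha (interior_subset hx)).differentiableAt.differentiableWithinAt
  · rw [interior_Ioi]
    intro s hs t ht hst
    rcases hst.eq_or_lt with rfl | hst
    · exact le_rfl
    rw [(fA_deriv ha hs).deriv, (fA_deriv ha ht).deriv]
    have h := (uA_anti hs hst).le
    have hus := uA_mem hs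
    have hut := uA_mem ht
    have := Real.pi_pos
    generalize (1 / Real.cosh s) ^ 2 = u at *
    generalize (1 / Real.cosh t) ^ 2 = v at *
    have hus' : u ∈ Set.Ico (0:ℝ) 1 := ⟨hus.1.le, hus.2⟩
    have hut' : v ∈ Set.Ico (0:ℝ) 1 := ⟨hut.1.le, hut.2⟩
    have h1 := HA_mono ha hut' hus' h
    have h2 := HA_nonneg ha hut'
    have h3 := HA_nonneg ha hus'
    have h4 := NA_anti ha hut' hus' h
    simp only at h4
    have hF := FA_pos ha hus'
    have h5 : 0 < 1 - u := by linarith [hus.2]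
    have h6 := hus.1.le
    gcongr

lemma ellK_pos {a : ℝ} (ha : a ∈ Set.Ioc (0:ℝ) (1/2)) {r : ℝ} (hr : r ∈ Set.Ico (0:ℝ) 1) :
    0 < ellK a r := by
  rw [ellK_eq]
  have h := FA_pos ha (x := r ^ 2) ⟨by positivity, by nlinarith [hr.1, hr.2]⟩
  have := Real.pi_pos
  positivity

lemma ellK_strict {a : ℝ} (ha : a ∈ Set.Ioc (0:ℝ) (1/2)) : StrictMonoOn (ellK a) (Set.Ico 0 1) := by
  intro r hr s hs hrs
  rw [ellK_eq, ellK_eq]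
  have := FA_strict ha (show r ^ 2 ∈ Set.Ico (0:ℝ) 1 from ⟨by positivity, by nlinarith [hr.1, hr.2]⟩)
    (show s ^ 2 ∈ Set.Ico (0:ℝ) 1 from ⟨by positivity, by nlinarith [hs.1, hs.2]⟩)
    (by nlinarith [hr.1])
  have := Real.pi_pos
  gcongr

lemma sech_mem {t : ℝ} (ht : 0 < t) : 1 / Real.cosh t ∈ Set.Ioo (0:ℝ) 1 := by
  have h := Real.one_lt_cosh.2 ht.ne'
  exact ⟨by positivity, by rw [div_lt_one (by linarith)]; exact h⟩

lemma fA_strict {a : ℝ} (ha : a ∈ Set.Ioc (0:ℝ) (1/2)) :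
    StrictMonoOn (fun x : ℝ => 1 / ellK a (1 / Real.cosh x)) (Set.Ioi 0) := by
  intro s hs t ht hst
  have h1 := Ioo_subset_Ico_self (sech_mem hs)
  have h2 := Ioo_subset_Ico_self (sech_mem ht)
  have h := Real.cosh_lt_cosh.2 (by rwa [abs_of_pos hs, abs_of_pos ht] : |s| < |t|)
  have := Real.cosh_pos s
  have h3 := ellK_strict ha h2 h1 (by gcongr)
  exact one_div_lt_one_div_of_lt (ellK_pos ha h2) h3

lemma fA_image {a : ℝ} (ha : a ∈ Set.Ioc (0:ℝ) (1/2)) :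
    (fun x : ℝ => 1 / ellK a (1 / Real.cosh x)) '' (Set.Ioi 0) = Set.Ioo 0 (2 / Real.pi) := by
  have hpi := Real.pi_pos
  have hp := pA_pos ha
  ext y
  constructor
  · rintro ⟨t, ht, rfl⟩
    have hu := uA_mem ht
    have h := ellK_pos ha (Ioo_subset_Ico_self (sech_mem ht))
    refine ⟨by positivity, ?_⟩
    have h1 := FA_strict ha (show (0:ℝ) ∈ Set.Ico (0:ℝ) 1 from ⟨le_rfl, one_pos⟩) ⟨hu.1.le, hu.2⟩ hu.1
    rw [FA_zero] at h1
    simp only [ellK_eq]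
    rw [div_lt_div_iff₀ (by positivity) hpi]
    nlinarith
  · rintro ⟨hy0, hy1⟩
    set A := 2 / (Real.pi * y) with hA
    have hA1 : 1 < A := by
      rw [hA, one_lt_div (by positivity)]
      rw [lt_div_iff₀ hpi] at hy1; linarith
    set x₁ := 1 - Real.exp (-(A / (a * (1 - a)))) with hx₁
    have he : Real.exp (-(A / (a * (1 - a)))) < 1 := by
      rw [Real.exp_lt_one_iff]
      have : 0 < A / (a * (1 - a)) := by positivity
      linarith
    have hx1 : x₁ ∈ Set.Ico (0:ℝ) 1 :=
      ⟨by linarith, by linarith [Real.exp_pos (-(A / (a * (1 - a))))]⟩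
    have hF1 : A ≤ FA a x₁ := by
      have h := FA_log ha hx1
      rw [hx₁, sub_sub_cancel, Real.log_exp, ← hx₁, neg_neg, mul_div_cancel₀ _ hp.ne'] at h
      exact h
    have hcont : ContinuousOn (FA a) (Set.Icc 0 x₁) := fun z hz =>
      (FA_deriv ha (by rw [abs_of_nonneg hz.1]; linarith [hz.2, hx1.2])).continuousAt.continuousWithinAt
    obtain ⟨x, hx, hxA⟩ := intermediate_value_Icc hx1.1 hcont
      (show A ∈ _ from ⟨by rw [FA_zero]; exact hA1.le, hF1⟩)
    have hx0 : 0 < x := by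
      rcases hx.1.eq_or_lt with h | h
      · rw [← h, FA_zero] at hxA; linarith
      · exact h
    have hxl : x < 1 := by linarith [hx.2, hx1.2]
    have hr0 : 0 < Real.sqrt x := Real.sqrt_pos.2 hx0
    have hr1 : Real.sqrt x < 1 := by rw [Real.sqrt_lt' one_pos]; simpa using hxl
    have hone : 1 < 1 / Real.sqrt x := by rw [one_lt_div hr0]; exact hr1
    refine ⟨Real.arcosh (1 / Real.sqrt x), Real.arcosh_pos hone, ?_⟩
    simp only [Real.cosh_arcosh hone.le, one_div_one_div, ellK_eq, Real.sq_sqrt hx0.le, hxA, hA]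
    field_simp

lemma fA_sub {a : ℝ} (ha : a ∈ Set.Ioc (0:ℝ) (1/2)) {x y : ℝ} (hx : 0 < x) (hy : 0 < y) :
    x * (1 / ellK a (1 / Real.cosh (x + y))) ≤ (x + y) * (1 / ellK a (1 / Real.cosh x)) := by
  set f := fun x : ℝ => 1 / ellK a (1 / Real.cosh x) with hf
  have hc : ConcaveOn ℝ (Set.Ioi 0) f := fA_concave ha
  change x * f (x + y) ≤ (x + y) * f x
  have hpos : ∀ t, 0 < t → 0 < f t := fun t ht => by
    have := ellK_pos ha (Ioo_subset_Ico_self (sech_mem ht))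
    simp only [hf]; positivity
  by_contra! hcon
  have hfp := hpos (x + y) (by linarith)
  have key : ∀ ε, 0 < ε → ε < x → (x - ε) * f (x + y) ≤ (x + y - ε) * f x := by
    intro ε h0 h1
    have h := hc.slope_anti_adjacent (x := ε) (y := x) (z := x + y) h0
      (show 0 < x + y by linarith) h1 (by linarith)
    rw [div_le_div_iff₀ (by linarith) (by linarith)] at h
    have := mul_pos (hpos ε h0) hy
    nlinarith
  set ε := min (x / 2) ((x * f (x + y) - (x + y) * f x) / (2 * f (x + y))) with hε
  have hε0 : 0 < ε := lt_min (by linarith) (div_pos (by linarith) (by positivity))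
  have hε1 : ε < x := (min_le_left _ _).trans_lt (by linarith)
  have hε2 : ε * (2 * f (x + y)) ≤ x * f (x + y) - (x + y) * f x := by
    rw [← le_div_iff₀ (by positivity)]; exact min_le_right _ _
  have := key ε hε0 hε1
  have := mul_pos hε0 (hpos x hx)
  have := mul_pos hε0 hfp
  nlinarith

lemma fA_subadd {a : ℝ} (ha : a ∈ Set.Ioc (0:ℝ) (1/2)) {x y : ℝ} (hx : 0 < x) (hy : 0 < y) :
    1 / ellK a (1 / Real.cosh (x + y)) ≤
      1 / ellK a (1 / Real.cosh x) + 1 / ellK a (1 / Real.cosh y) := by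
  have h1 := fA_sub ha hx hy
  have h2 := fA_sub ha hy hx
  rw [add_comm y x] at h2
  have h3 : 0 < x + y := by linarith
  refine le_of_mul_le_mul_left ?_ h3
  linarith

lemma ineqs {a : ℝ} (ha : a ∈ Set.Ioc (0:ℝ) (1/2)) {r s : ℝ} (hr : r ∈ Set.Ioo (0:ℝ) 1)
    (hs : s ∈ Set.Ioo (0:ℝ) 1) :
    ellK a r * ellK a s /
        ellK a (r * s / (1 + Real.sqrt (1 - r ^ 2) * Real.sqrt (1 - s ^ 2))) ≤
        ellK a r + ellK a s ∧
      ellK a r + ellK a s ≤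
        2 * ellK a r * ellK a s /
          ellK a (Real.sqrt (2 * r * s /
            (1 + r * s + Real.sqrt (1 - r ^ 2) * Real.sqrt (1 - s ^ 2)))) := by
  have par : ∀ r : ℝ, r ∈ Set.Ioo (0:ℝ) 1 → ∃ x : ℝ, 0 < x ∧ Real.cosh x = 1 / r ∧
      Real.sinh x = Real.sqrt (1 - r ^ 2) / r := by
    intro r hr
    have h0 := hr.1
    have h : 1 < 1 / r := by rw [one_lt_div hr.1]; exact hr.2
    refine ⟨Real.arcosh (1 / r), Real.arcosh_pos h, Real.cosh_arcosh h.le, ?_⟩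
    rw [Real.sinh_arcosh h.le]
    have e : (1 / r) ^ 2 - 1 = (1 - r ^ 2) / r ^ 2 := by field_simp
    rw [e, Real.sqrt_div' _ (by positivity), Real.sqrt_sq h0.le]
  obtain ⟨x, hx, hcx, hsx⟩ := par r hr
  obtain ⟨y, hy, hcy, hsy⟩ := par s hs
  have hr0 := hr.1
  have hs0 := hs.1
  have hr' := Real.sqrt_nonneg (1 - r ^ 2)
  have hs' := Real.sqrt_nonneg (1 - s ^ 2)
  generalize Real.sqrt (1 - r ^ 2) = r' at *
  generalize Real.sqrt (1 - s ^ 2) = s' at *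
  have hrs' : 0 ≤ r' * s' := by positivity
  have hadd : Real.cosh (x + y) = (1 + r' * s') / (r * s) := by
    rw [Real.cosh_add, hcx, hcy, hsx, hsy]; field_simp
  have e1 : r * s / (1 + r' * s') = 1 / Real.cosh (x + y) := by
    rw [hadd]; field_simp
  have e2 : Real.sqrt (2 * r * s / (1 + r * s + r' * s')) = 1 / Real.cosh ((x + y) / 2) := by
    have hc := Real.cosh_pos ((x + y) / 2)
    rw [Real.sqrt_eq_iff_mul_self_eq (by positivity) (by positivity)]
    have h2 := Real.cosh_two_mul ((x + y) / 2)
    have h3 := Real.cosh_sq ((x + y) / 2)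
    rw [mul_div_cancel₀ _ (two_ne_zero), hadd] at h2
    have h4 : Real.cosh ((x + y) / 2) ^ 2 = (1 + r * s + r' * s') / (2 * r * s) := by
      have : Real.cosh ((x + y) / 2) ^ 2 = ((1 + r' * s') / (r * s) + 1) / 2 := by linarith
      rw [this]; field_simp; ring
    rw [div_mul_div_comm, ← sq (Real.cosh _), h4, one_mul, one_div_div]
  have hKr := ellK_pos ha (Ioo_subset_Ico_self hr)
  have hKs := ellK_pos ha (Ioo_subset_Ico_self hs)
  have hxy : 0 < x + y := by linarith
  have hs1 := fA_subadd ha hx hy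
  have hc := (fA_concave ha).2 (show x ∈ Set.Ioi (0:ℝ) from hx) (show y ∈ Set.Ioi (0:ℝ) from hy)
    (show (0:ℝ) ≤ 1/2 by norm_num) (show (0:ℝ) ≤ 1/2 by norm_num) (by norm_num)
  simp only [smul_eq_mul] at hc
  have e3 : 1 / 2 * x + 1 / 2 * y = (x + y) / 2 := by ring
  rw [e3, ← e2, hcx, hcy, one_div_one_div, one_div_one_div] at hc
  rw [← e1, hcx, hcy, one_div_one_div, one_div_one_div] at hs1
  have hid : ellK a r + ellK a s = ellK a r * ellK a s * (1 / ellK a r + 1 / ellK a s) := by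
    field_simp; ring
  have hprod := mul_pos hKr hKs
  constructor
  · rw [hid, div_eq_mul_one_div]
    gcongr
  · have h7 := mul_le_mul_of_nonneg_left hc (mul_pos two_pos hprod).le
    calc _ = 2 * (ellK a r * ellK a s) * (1 / 2 * (1 / ellK a r) + 1 / 2 * (1 / ellK a s)) := by
            rw [hid]; ring
      _ ≤ _ := h7
      _ = _ := by rw [mul_one_div, ← mul_assoc 2 (ellK a r)]

lemma third {a : ℝ} (ha : a ∈ Set.Ioc (0:ℝ) (1/2)) {r s : ℝ} (hr : r ∈ Set.Ioo (0:ℝ) 1)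
    (hs : s ∈ Set.Ioo (0:ℝ) 1) :
      2 * ellK a r * ellK a s /
          ellK a (Real.sqrt (2 * r * s /
            (1 + r * s + Real.sqrt (1 - r ^ 2) * Real.sqrt (1 - s ^ 2)))) ≤
        2 * ellK a r * ellK a s / ellK a (Real.sqrt (r * s)) ∧
      (2 * ellK a r * ellK a s /
          ellK a (Real.sqrt (2 * r * s /
            (1 + r * s + Real.sqrt (1 - r ^ 2) * Real.sqrt (1 - s ^ 2)))) =
        2 * ellK a r * ellK a s / ellK a (Real.sqrt (r * s)) ↔ r = s) := by
  have hr0 := hr.1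
  have hs0 := hs.1
  have hr1 := hr.2
  have hs1 := hs.2
  have hKr := ellK_pos ha (Ioo_subset_Ico_self hr)
  have hKs := ellK_pos ha (Ioo_subset_Ico_self hs)
  have hr' := Real.sqrt_pos.2 (show 0 < 1 - r ^ 2 by nlinarith)
  have hs' := Real.sqrt_pos.2 (show 0 < 1 - s ^ 2 by nlinarith)
  have hrq := Real.sq_sqrt (show 0 ≤ 1 - r ^ 2 by nlinarith)
  have hsq := Real.sq_sqrt (show 0 ≤ 1 - s ^ 2 by nlinarith)
  have heq : r = s → 1 + r * s + Real.sqrt (1 - r ^ 2) * Real.sqrt (1 - s ^ 2) = 2 := by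
    rintro rfl; nlinarith
  generalize Real.sqrt (1 - r ^ 2) = r' at *
  generalize Real.sqrt (1 - s ^ 2) = s' at *
  have hrs : 0 < r * s := by positivity
  have hrs1 : r * s < 1 := by nlinarith
  have hlt : r ≠ s → 1 + r * s + r' * s' < 2 := by
    intro h
    have := sq_pos_of_ne_zero (sub_ne_zero.2 h)
    nlinarith [sq_nonneg (r' - s')]
  have hst : r ≠ s → 2 * ellK a r * ellK a s /
      ellK a (Real.sqrt (2 * r * s / (1 + r * s + r' * s'))) <
        2 * ellK a r * ellK a s / ellK a (Real.sqrt (r * s)) := by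
    intro h
    have h2 := hlt h
    have hsum : r * s < r' * s' + 1 := by nlinarith [mul_pos hr' hs']
    have h3 : r * s < 2 * r * s / (1 + r * s + r' * s') := by
      rw [lt_div_iff₀ (by positivity)]; nlinarith
    have h4 : 2 * r * s / (1 + r * s + r' * s') < 1 := by
      rw [div_lt_one (by positivity)]; nlinarith
    have m1 : Real.sqrt (r * s) ∈ Set.Ico (0:ℝ) 1 :=
      ⟨Real.sqrt_nonneg _, by rw [Real.sqrt_lt' one_pos]; simpa using hrs1⟩
    have m2 : Real.sqrt (2 * r * s / (1 + r * s + r' * s')) ∈ Set.Ico (0:ℝ) 1 :=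
      ⟨Real.sqrt_nonneg _, by rw [Real.sqrt_lt' one_pos]; simpa using h4⟩
    have h5 := ellK_strict ha m1 m2 (Real.sqrt_lt_sqrt hrs.le h3)
    exact div_lt_div_of_pos_left (by positivity) (ellK_pos ha m1) h5
  have hE : r = s → 2 * ellK a r * ellK a s /
      ellK a (Real.sqrt (2 * r * s / (1 + r * s + r' * s'))) =
        2 * ellK a r * ellK a s / ellK a (Real.sqrt (r * s)) := by
    intro h
    rw [heq h]
    congr 3
    ring
  by_cases h : r = s
  · exact ⟨(hE h).le, fun _ => h, hE⟩
  · exact ⟨(hst h).le, fun e => absurd e (hst h).ne, hE⟩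

theorem stmt3 (a : ℝ) (ha : a ∈ Set.Ioc (0:ℝ) (1/2)) :
    StrictMonoOn (fun x : ℝ => 1 / ellK a (1 / Real.cosh x)) (Set.Ioi 0) ∧
    ConcaveOn ℝ (Set.Ioi 0) (fun x : ℝ => 1 / ellK a (1 / Real.cosh x)) ∧
    (fun x : ℝ => 1 / ellK a (1 / Real.cosh x)) '' (Set.Ioi 0) =
      Set.Ioo 0 (2 / Real.pi) ∧
    ∀ r s : ℝ, r ∈ Set.Ioo (0:ℝ) 1 → s ∈ Set.Ioo (0:ℝ) 1 →
      ellK a r * ellK a s /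
        ellK a (r * s / (1 + Real.sqrt (1 - r ^ 2) * Real.sqrt (1 - s ^ 2))) ≤
        ellK a r + ellK a s ∧
      ellK a r + ellK a s ≤
        2 * ellK a r * ellK a s /
          ellK a (Real.sqrt (2 * r * s /
            (1 + r * s + Real.sqrt (1 - r ^ 2) * Real.sqrt (1 - s ^ 2)))) ∧
      2 * ellK a r * ellK a s /
          ellK a (Real.sqrt (2 * r * s /
            (1 + r * s + Real.sqrt (1 - r ^ 2) * Real.sqrt (1 - s ^ 2)))) ≤
        2 * ellK a r * ellK a s / ellK a (Real.sqrt (r * s)) ∧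
      (2 * ellK a r * ellK a s /
          ellK a (Real.sqrt (2 * r * s /
            (1 + r * s + Real.sqrt (1 - r ^ 2) * Real.sqrt (1 - s ^ 2)))) =
        2 * ellK a r * ellK a s / ellK a (Real.sqrt (r * s)) ↔ r = s) := by
  refine ⟨fA_strict ha, fA_concave ha, fA_image ha, fun r s hr hs => ?_⟩
  obtain ⟨h1, h2⟩ := ineqs ha hr hs
  obtain ⟨h3, h4⟩ := third ha hr hs
  exact ⟨h1, h2, h3, h4⟩
end

section
/- Let p ≥ 2, a = 1/p, π_p = 2π/(p sin(π/p)), and for r ∈ (0,1), r' = √(1-r²), set l_p(r) = (π_p/2)²·(p² - (p-1) log r²)/(p·π_p - 2 log r'²) and u_p(r) = (p/2)²·(p·π_p - 2 log r²)/(p² - (p-1) log r'²). Then (1) l_p(r) < μ_a(r) < u_p(r) for all r ∈ (0,1), and (2) for p = 2, u_2(r) < (4/π)·l_2(r) for all r ∈ (0,1). -/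
open Real Set

noncomputable def dn (a : ℝ) (n : ℕ) : ℝ :=
  shiftedFact a (n+1) * shiftedFact (1 - a) (n+1) / ((n.factorial : ℝ) * ((n+1).factorial : ℝ))

lemma sf_pos (a : ℝ) (ha : 0 < a) (n : ℕ) : 0 < shiftedFact a n := by
  induction n with
  | zero => simp [shiftedFact]
  | succ n ih => simp only [shiftedFact]; positivity

lemma sf_one (n : ℕ) : shiftedFact 1 n = n.factorial := by
  induction n with
  | zero => simp [shiftedFact]
  | succ n ih => simp only [shiftedFact, ih, Nat.factorial_succ]; push_cast; ring

lemma sf_prod (a : ℝ) (n : ℕ) : shiftedFact a n = ∏ j ∈ Finset.range n, (a + j) := by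
  induction n with
  | zero => simp [shiftedFact]
  | succ n ih => simp only [shiftedFact, ih, Finset.prod_range_succ]

lemma dn_pos (a : ℝ) (ha : 0 < a) (ha' : a < 1) (n : ℕ) : 0 < dn a n := by
  have h1 := sf_pos a ha (n+1)
  have h2 := sf_pos (1-a) (by linarith) (n+1)
  unfold dn; positivity

lemma dn_zero (a : ℝ) : dn a 0 = a * (1 - a) := by
  simp [dn, shiftedFact]

lemma dn_succ (a : ℝ) (n : ℕ) :
    dn a (n+1) = dn a n * (1 + a * (1 - a) / (((n:ℝ)+1) * (n+2))) := by
  unfold dn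
  rw [show shiftedFact a (n+1+1) = shiftedFact a (n+1) * (a + ((n+1:ℕ):ℝ)) from rfl,
    show shiftedFact (1-a) (n+1+1) = shiftedFact (1-a) (n+1) * (1-a + ((n+1:ℕ):ℝ)) from rfl]
  simp only [Nat.factorial_succ]
  have : (n.factorial : ℝ) ≠ 0 := by positivity
  push_cast
  field_simp
  ring

lemma dn_mono (a : ℝ) (ha : 0 < a) (ha' : a < 1) : StrictMono (dn a) := by
  apply strictMono_nat_of_lt_succ
  intro n
  rw [dn_succ]
  have h := dn_pos a ha ha' n
  have : 0 < 1 - a := by linarith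
  have : 0 < a * (1 - a) / (((n:ℝ)+1) * (n+2)) := by positivity
  nlinarith

lemma dn_lim (a : ℝ) (ha : 0 < a) (ha' : a < 1) :
    Filter.Tendsto (dn a) Filter.atTop (nhds (sin (π * a) / π)) := by
  have hs : 0 < sin (π * a) := Real.sin_pos_of_pos_of_lt_pi (by positivity) (by nlinarith [pi_pos])
  have h := (Real.GammaSeq_tendsto_Gamma a).mul (Real.GammaSeq_tendsto_Gamma (1 - a))
  rw [Real.Gamma_mul_Gamma_one_sub] at h
  have h2 := (tendsto_natCast_div_add_atTop (1:ℝ)).mul (h.inv₀ (by positivity))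
  rw [one_mul, inv_div] at h2
  refine h2.congr' ?_
  filter_upwards [Filter.eventually_gt_atTop 0] with n hn
  have hn' : (0:ℝ) < n := by exact_mod_cast hn
  have e : (n:ℝ) ^ a * (n:ℝ) ^ (1 - a) = n := by
    rw [← Real.rpow_add hn']; simp
  have h1 := sf_pos a ha (n+1)
  have h3 := sf_pos (1-a) (by linarith) (n+1)
  unfold Real.GammaSeq dn
  rw [← sf_prod, ← sf_prod, Nat.factorial_succ]
  push_cast
  have hf : (n.factorial : ℝ) ≠ 0 := by positivity
  have e1 : (n:ℝ) ^ a ≠ 0 := (Real.rpow_pos_of_pos hn' _).ne'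
  have e2 : (n:ℝ) ^ (1-a) ≠ 0 := (Real.rpow_pos_of_pos hn' _).ne'
  field_simp
  linear_combination -e

lemma dn_lt (a : ℝ) (ha : 0 < a) (ha' : a < 1) (n : ℕ) : dn a n < sin (π * a) / π :=
  (dn_mono a ha ha' (Nat.lt_succ_self n)).trans_le
    ((dn_mono a ha ha').monotone.ge_of_tendsto (dn_lim a ha ha') _)

lemma dn_ge (a : ℝ) (ha : 0 < a) (ha' : a < 1) (n : ℕ) : a * (1 - a) ≤ dn a n := by
  rw [← dn_zero]; exact (dn_mono a ha ha').monotone (Nat.zero_le n)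

lemma hypF_bounds (a x : ℝ) (ha : 0 < a) (ha' : a < 1) (hx : 0 < x) (hx' : x < 1) :
    1 - a * (1 - a) * log (1 - x) < hypF a (1 - a) 1 x ∧
    hypF a (1 - a) 1 x < 1 - sin (π * a) / π * log (1 - x) := by
  have hl := Real.hasSum_pow_div_log_of_abs_lt_one (x := x) (by rw [abs_of_pos hx]; exact hx')
  have hlo := hl.mul_left (a * (1 - a))
  have hhi := hl.mul_left (sin (π * a) / π)
  have hq : ∀ n : ℕ, 0 < x ^ (n+1) / ((n:ℝ)+1) := fun n => by positivity
  have hsum : Summable (fun n : ℕ => dn a n * (x ^ (n+1) / ((n:ℝ)+1))) :=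
    Summable.of_nonneg_of_le (fun n => (mul_pos (dn_pos a ha ha' n) (hq n)).le)
      (fun n => mul_le_mul_of_nonneg_right (dn_lt a ha ha' n).le (hq n).le) hhi.summable
  have heq : hypF a (1 - a) 1 x = 1 + ∑' n : ℕ, dn a n * (x ^ (n+1) / ((n:ℝ)+1)) := by
    have ht : ∀ n : ℕ, shiftedFact a (n+1) * shiftedFact (1-a) (n+1) /
        (shiftedFact 1 (n+1) * ((n+1).factorial : ℝ)) * x ^ (n+1)
        = dn a n * (x ^ (n+1) / ((n:ℝ)+1)) := by
      intro n
      rw [sf_one]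
      unfold dn
      have hf : (n.factorial : ℝ) ≠ 0 := by positivity
      simp only [Nat.factorial_succ]
      push_cast
      field_simp
    unfold hypF
    rw [Summable.tsum_eq_zero_add ((summable_nat_add_iff 1).1 (hsum.congr fun n => (ht n).symm))]
    simp only [ht]
    simp [shiftedFact]
  rw [heq]
  have h1 : a * (1 - a) * -log (1 - x) < ∑' n : ℕ, dn a n * (x ^ (n+1) / ((n:ℝ)+1)) := by
    rw [← hlo.tsum_eq]
    refine Summable.tsum_lt_tsum (i := 1)
      (fun n => mul_le_mul_of_nonneg_right (dn_ge a ha ha' n) (hq n).le)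
      ?_ hlo.summable hsum
    refine mul_lt_mul_of_pos_right ?_ (hq 1)
    rw [← dn_zero]; exact dn_mono a ha ha' Nat.zero_lt_one
  have h2 : ∑' n : ℕ, dn a n * (x ^ (n+1) / ((n:ℝ)+1)) < sin (π * a) / π * -log (1 - x) := by
    rw [← hhi.tsum_eq]
    exact Summable.tsum_lt_tsum (i := 0)
      (fun n => mul_le_mul_of_nonneg_right (dn_lt a ha ha' n).le (hq n).le)
      (mul_lt_mul_of_pos_right (dn_lt a ha ha' 0) (hq 0)) hsum hhi.summable
  constructor <;> linarith

theorem stmt4 (p : ℝ) (hp : 2 ≤ p) :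
    (∀ r : ℝ, r ∈ Set.Ioo (0:ℝ) 1 →
      (2 * Real.pi / (p * Real.sin (Real.pi / p)) / 2) ^ 2 *
          ((p ^ 2 - (p - 1) * Real.log (r ^ 2)) /
            (p * (2 * Real.pi / (p * Real.sin (Real.pi / p))) -
              2 * Real.log (1 - r ^ 2))) < muFn (1 / p) r ∧
      muFn (1 / p) r <
        (p / 2) ^ 2 *
          ((p * (2 * Real.pi / (p * Real.sin (Real.pi / p))) - 2 * Real.log (r ^ 2)) /
            (p ^ 2 - (p - 1) * Real.log (1 - r ^ 2)))) ∧
    (p = 2 → ∀ r : ℝ, r ∈ Set.Ioo (0:ℝ) 1 →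
      (2 / 2 : ℝ) ^ 2 *
          ((2 * (2 * Real.pi / (2 * Real.sin (Real.pi / 2))) - 2 * Real.log (r ^ 2)) /
            (2 ^ 2 - (2 - 1) * Real.log (1 - r ^ 2))) <
        4 / Real.pi *
          ((2 * Real.pi / (2 * Real.sin (Real.pi / 2)) / 2) ^ 2 *
            ((2 ^ 2 - (2 - 1) * Real.log (r ^ 2)) /
              (2 * (2 * Real.pi / (2 * Real.sin (Real.pi / 2))) -
                2 * Real.log (1 - r ^ 2))))) := by
  constructor
  · intro r hr
    obtain ⟨hr0, hr1⟩ := hr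
    have hp0 : 0 < p := by linarith
    have ha : 0 < 1 / p := by positivity
    have ha' : 1 / p < 1 := by rw [div_lt_one hp0]; linarith
    have hx : 0 < r ^ 2 := by positivity
    have hx' : r ^ 2 < 1 := by nlinarith
    have hs : 0 < sin (π / p) :=
      Real.sin_pos_of_pos_of_lt_pi (by positivity) (by rw [div_lt_iff₀ hp0]; nlinarith [pi_pos])
    obtain ⟨b1, b2⟩ := hypF_bounds (1/p) (r^2) ha ha' hx hx'
    obtain ⟨b3, b4⟩ := hypF_bounds (1/p) (1 - r^2) ha ha' (by linarith) (by linarith)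
    have hA : log (r ^ 2) < 0 := Real.log_neg hx hx'
    have hB : log (1 - r ^ 2) < 0 := Real.log_neg (by linarith) (by linarith)
    rw [sub_sub_cancel] at b3 b4
    have hpi := pi_pos
    have hmu : muFn (1/p) r = π / (2 * sin (π / p)) *
        (hypF (1/p) (1 - 1/p) 1 (1 - r^2) / hypF (1/p) (1 - 1/p) 1 (r^2)) := by
      unfold muFn ellK
      rw [Real.sq_sqrt (by linarith), mul_one_div, mul_div_assoc, mul_div_mul_left _ _ (by positivity)]
    rw [hmu]
    rw [mul_one_div] at b2 b4
    generalize hypF (1/p) (1 - 1/p) 1 (r^2) = F at *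
    generalize hypF (1/p) (1 - 1/p) 1 (1 - r^2) = G at *
    generalize log (r^2) = A at *
    generalize log (1 - r^2) = B at *
    generalize sin (π / p) = s at *
    have hc : 0 < 1 / p * (1 - 1 / p) := mul_pos ha (by linarith)
    have hd : 0 < s / π := by positivity
    have q1 : 0 < 1 - 1 / p * (1 - 1 / p) * A := by nlinarith
    have q2 : 0 < 1 - 1 / p * (1 - 1 / p) * B := by nlinarith
    have q3 : 0 < 1 - s / π * A := by nlinarith
    have q4 : 0 < 1 - s / π * B := by nlinarith
    have hk : 0 < π / (2 * s) := by positivity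
    have n1 : p ^ 2 - (p - 1) * A = p ^ 2 * (1 - 1 / p * (1 - 1 / p) * A) := by field_simp
    have n2 : p ^ 2 - (p - 1) * B = p ^ 2 * (1 - 1 / p * (1 - 1 / p) * B) := by field_simp
    have n3 : p * (2 * π / (p * s)) - 2 * A = 2 * π / s * (1 - s / π * A) := by field_simp
    have n4 : p * (2 * π / (p * s)) - 2 * B = 2 * π / s * (1 - s / π * B) := by field_simp
    rw [n1, n2, n3, n4]
    generalize 1 - 1 / p * (1 - 1 / p) * A = X at *
    generalize 1 - 1 / p * (1 - 1 / p) * B = Y at *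
    generalize 1 - s / π * A = Z at *
    generalize 1 - s / π * B = W at *
    have hF : 0 < F := by linarith
    constructor
    · have : (2 * π / (p * s) / 2) ^ 2 * (p ^ 2 * X / (2 * π / s * W)) = π / (2 * s) * (X / W) := by
        field_simp
      rw [this]
      apply mul_lt_mul_of_pos_left _ hk
      rw [div_lt_div_iff₀ q4 hF]
      nlinarith
    · have : (p / 2) ^ 2 * (2 * π / s * Z / (p ^ 2 * Y)) = π / (2 * s) * (Z / Y) := by
        field_simp
        try norm_num
      rw [this]
      apply mul_lt_mul_of_pos_left _ hk
      rw [div_lt_div_iff₀ hF q2]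
      nlinarith
  · intro _ r hr
    obtain ⟨hr0, hr1⟩ := hr
    have hx : 0 < r ^ 2 := by positivity
    have hx' : r ^ 2 < 1 := by nlinarith
    have hy : 0 < 1 - r ^ 2 := by linarith
    have hA : log (r ^ 2) < 0 := Real.log_neg hx hx'
    have hB : log (1 - r ^ 2) < 0 := Real.log_neg (by linarith) (by linarith)
    have h1 := Real.one_sub_inv_le_log_of_pos hx
    have h2 := Real.one_sub_inv_le_log_of_pos hy
    have hAB : log (r^2) * log (1 - r^2) ≤ 1 := by
      have h3 : (-log (r^2)) * (-log (1 - r^2)) ≤ ((r^2)⁻¹ - 1) * ((1 - r^2)⁻¹ - 1) := by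
        apply mul_le_mul <;> linarith
      have h4 : ((r^2)⁻¹ - 1) * ((1 - r^2)⁻¹ - 1) = 1 := by
        have := hy.ne'
        field_simp
        ring
      linarith
    have hpi := Real.pi_gt_three
    have hpi4 := Real.pi_lt_four
    rw [Real.sin_pi_div_two]
    generalize log (r^2) = A at *
    generalize log (1 - r^2) = B at *
    have : 4 / π * ((2 * π / (2 * 1) / 2) ^ 2 * ((2 ^ 2 - (2 - 1) * A) / (2 * (2 * π / (2 * 1)) - 2 * B)))
        = π * (4 - A) / (2 * π - 2 * B) := by
      have : 2 * π - 2 * B ≠ 0 := by linarith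
      have : π - B ≠ 0 := by linarith
      field_simp
      try ring
    rw [this]
    have : (2 / 2 : ℝ) ^ 2 * ((2 * (2 * π / (2 * 1)) - 2 * A) / (2 ^ 2 - (2 - 1) * B))
        = (2 * π - 2 * A) / (4 - B) := by norm_num
    rw [this, div_lt_div_iff₀ (by linarith) (by linarith)]
    nlinarith [mul_pos (show 0 < 4 - π by linarith) (show 0 < 4 * π - A * B by linarith)]
end
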